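/- Let n ≥ 1, let λ₁, λ₂, λ₃ be pairwise distinct nonzero complex numbers with f(x) = (x−λ₁)(x−λ₂)(x−λ₃), and fix λ ∈ ℂ with λ² = −λ₁λ₂λ₃. Define the points αₙ, βₙ ∈ Xₙ(ℂ) by: αₙ has pᵢ = 1 for even i and pᵢ = 0 for odd i (0 ≤ i ≤ n), qᵢ = λ for odd i and qᵢ = 0 for even i (1 ≤ i ≤ n); βₙ has pᵢ = 0 for even i and pᵢ = 1 for odd i, qᵢ = 0 for odd i and qᵢ = λ for even i. Then αₙ and βₙ are valid points of Xₙ(ℂ), and they are NOT 𝔸¹-chain equivalent in Xₙ(ℂ). (These are the alternating points αₙ = (α₁, β₁, α₁, …) and βₙ = (β₁, α₁, β₁, …) of the paper, whose images remain distinct in Sⁿ(Xₙ)(ℂ); in particular they are distinct already in the naive 𝔸¹-connected components of the ℂ-points.) -/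

import Mathlib

open Polynomial

/-- `f` applied to a complex number. -/
noncomputable def fC (l1 l2 l3 z : ℂ) : ℂ := (z - l1) * (z - l2) * (z - l3)

/-- `f` applied to a polynomial. -/
noncomputable def fP (l1 l2 l3 : ℂ) (p : Polynomial ℂ) : Polynomial ℂ :=
  (p - C l1) * (p - C l2) * (p - C l3)

/-- The set `Xₙ(ℂ)` of tuples `(p₀,…,pₙ,q₁,…,qₙ)` with `qᵢ² = pᵢ₋₁²·f(pᵢ)` and
`(pᵢ₋₁, pᵢ, qᵢ) ≠ (0,0,0)` for all `1 ≤ i ≤ n`.  Here `p j` is `p_j` for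
`j : Fin (n+1)` and `q i` is `q_{i+1}` for `i : Fin n`. -/
def XnSet (l1 l2 l3 : ℂ) (n : ℕ) : Set ((Fin (n + 1) → ℂ) × (Fin n → ℂ)) :=
  {v | ∀ i : Fin n,
    v.2 i ^ 2 = v.1 i.castSucc ^ 2 * fC l1 l2 l3 (v.1 i.succ) ∧
    ¬ (v.1 i.castSucc = 0 ∧ v.1 i.succ = 0 ∧ v.2 i = 0)}

/-- Elementary 𝔸¹-homotopy relation on `Xₙ(ℂ)`. -/
def chainReln (l1 l2 l3 : ℂ) (n : ℕ) (v w : XnSet l1 l2 l3 n) : Prop :=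
  ∃ (a : Fin (n + 1) → Polynomial ℂ) (b : Fin n → Polynomial ℂ),
    (∀ i : Fin n, (b i) ^ 2 = (a i.castSucc) ^ 2 * fP l1 l2 l3 (a i.succ)) ∧
    (∀ i : Fin n, ∀ t : ℂ,
      ¬ ((a i.castSucc).eval t = 0 ∧ (a i.succ).eval t = 0 ∧ (b i).eval t = 0)) ∧
    (∀ j, (a j).eval 0 = v.val.1 j) ∧ (∀ i, (b i).eval 0 = v.val.2 i) ∧
    (∀ j, (a j).eval 1 = w.val.1 j) ∧ (∀ i, (b i).eval 1 = w.val.2 i)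

/-- The `p`-coordinates of the point `αₙ`: `pᵢ = 1` for even `i`, `pᵢ = 0` for odd `i`. -/
def alphaP (n : ℕ) : Fin (n + 1) → ℂ := fun i => if Even (i : ℕ) then 1 else 0

/-- The `q`-coordinates of the point `αₙ`: `qⱼ = λ` for odd `j`, `qⱼ = 0` for even `j`
(the index `i : Fin n` corresponds to `j = i + 1`). -/
def alphaQ (lam : ℂ) (n : ℕ) : Fin n → ℂ := fun i => if Even (i : ℕ) then lam else 0

/-- The `p`-coordinates of the point `βₙ`: `pᵢ = 0` for even `i`, `pᵢ = 1` for odd `i`. -/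
def betaP (n : ℕ) : Fin (n + 1) → ℂ := fun i => if Even (i : ℕ) then 0 else 1

/-- The `q`-coordinates of the point `βₙ`: `qⱼ = 0` for odd `j`, `qⱼ = λ` for even `j`. -/
def betaQ (lam : ℂ) (n : ℕ) : Fin n → ℂ := fun i => if Even (i : ℕ) then 0 else lam

/-- If two coprime complex polynomials have square product, then the first is a square. -/
theorem exists_sq_eq_of_coprime_mul_eq_sq {p q r : ℂ[X]} (hpq : IsCoprime p q)
    (h : p * q = r ^ 2) : ∃ u : ℂ[X], p = u ^ 2 := by
  obtain ⟨d, w, hd⟩ := exists_associated_pow_of_mul_eq_pow' hpq h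
  obtain ⟨z, -, hz⟩ := Polynomial.isUnit_iff.1 w.isUnit
  obtain ⟨s, hs⟩ := IsAlgClosed.exists_pow_nat_eq z (n := 2) two_pos
  refine ⟨d * C s, ?_⟩
  rw [← hd, ← hz, mul_pow, ← C_pow, hs]

theorem isCoprime_sub_C_sub_C {x y : ℂ} (p : ℂ[X]) (h : x ≠ y) :
    IsCoprime (p - C x) (p - C y) := by
  have hyx : y - x ≠ 0 := sub_ne_zero.2 h.symm
  refine ⟨C (y - x)⁻¹, -C (y - x)⁻¹, ?_⟩
  calc C (y - x)⁻¹ * (p - C x) + -C (y - x)⁻¹ * (p - C y)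
      = C ((y - x)⁻¹ * (y - x)) := by rw [C_mul, C_sub]; ring
    _ = 1 := by rw [inv_mul_cancel₀ hyx, C_1]

/-- Every polynomial map from the affine line to the affine curve `y² = (x-l1)(x-l2)(x-l3)`
with distinct roots is constant. -/
theorem exists_eq_C_of_sq_eq_fP {l1 l2 l3 : ℂ} (h12 : l1 ≠ l2) (h13 : l1 ≠ l3) (h23 : l2 ≠ l3)
    {p r : ℂ[X]} (h : r ^ 2 = fP l1 l2 l3 p) : ∃ z, p = C z := by
  unfold fP at h
  obtain ⟨u, hu⟩ := exists_sq_eq_of_coprime_mul_eq_sq (r := r)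
    ((isCoprime_sub_C_sub_C p h12).mul_right (isCoprime_sub_C_sub_C p h13)) (by rw [h]; ring)
  obtain ⟨v, hv⟩ := exists_sq_eq_of_coprime_mul_eq_sq (r := r)
    ((isCoprime_sub_C_sub_C p h12.symm).mul_right (isCoprime_sub_C_sub_C p h23)) (by rw [h]; ring)
  have huv : (u - v) * (u + v) = C (l2 - l1) := by
    rw [C_sub]; linear_combination hv - hu
  have hunit : IsUnit ((u - v) * (u + v)) := by
    rw [huv]; exact isUnit_C.2 (sub_ne_zero.2 h12.symm).isUnit
  obtain ⟨x, -, hx⟩ := Polynomial.isUnit_iff.1 (isUnit_of_mul_isUnit_left hunit)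
  obtain ⟨y, -, hy⟩ := Polynomial.isUnit_iff.1 (isUnit_of_mul_isUnit_right hunit)
  have hu2 : u = C ((x + y) / 2) := by
    have h2 : C (2 : ℂ) * u = C (2 : ℂ) * C ((x + y) / 2) := by
      rw [← C_mul, mul_div_cancel₀ _ two_ne_zero, C_add, hx, hy, show C (2 : ℂ) = 2 from rfl]
      ring
    exact mul_left_cancel₀ (C_ne_zero.2 two_ne_zero) h2
  refine ⟨((x + y) / 2) ^ 2 + l1, ?_⟩
  rw [C_add, C_pow, ← hu2, ← hu, sub_add_cancel]

/-- Along an elementary homotopy, every coordinate `pᵢ` with `i ≥ 1` is constant. -/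
theorem chainReln_fst_succ_eq {l1 l2 l3 : ℂ} (h12 : l1 ≠ l2) (h13 : l1 ≠ l3) (h23 : l2 ≠ l3)
    {n : ℕ} {v w : XnSet l1 l2 l3 n} (h : chainReln l1 l2 l3 n v w) (i : Fin n) :
    v.val.1 i.succ = w.val.1 i.succ := by
  obtain ⟨a, b, hab, hne, ha0, -, ha1, -⟩ := h
  suffices ∃ z, a i.succ = C z by
    obtain ⟨z, hz⟩ := this
    rw [← ha0, ← ha1, hz, eval_C, eval_C]
  by_cases h0 : a i.castSucc = 0
  · have hb : b i = 0 := by simpa [h0] using hab i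
    refine ⟨_, eq_C_of_degree_eq_zero (by_contra fun hdeg => ?_)⟩
    obtain ⟨t, ht⟩ := IsAlgClosed.exists_root (a i.succ) hdeg
    exact hne i t ⟨by rw [h0, eval_zero], ht, by rw [hb, eval_zero]⟩
  · obtain ⟨r, hr⟩ := (IsIntegrallyClosed.pow_dvd_pow_iff two_ne_zero).1 (Dvd.intro _ (hab i).symm)
    refine exists_eq_C_of_sq_eq_fP h12 h13 h23 (r := r) ?_
    have hi := hab i
    rw [hr, mul_pow] at hi
    exact mul_left_cancel₀ (pow_ne_zero 2 h0) hi

theorem eqvGen_chainReln_fst_succ_eq {l1 l2 l3 : ℂ} (h12 : l1 ≠ l2) (h13 : l1 ≠ l3)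
    (h23 : l2 ≠ l3) {n : ℕ} {v w : XnSet l1 l2 l3 n}
    (h : Relation.EqvGen (chainReln l1 l2 l3 n) v w) (i : Fin n) :
    v.val.1 i.succ = w.val.1 i.succ := by
  induction h with
  | rel _ _ h => exact chainReln_fst_succ_eq h12 h13 h23 h i
  | refl _ => rfl
  | symm _ _ _ ih => exact ih.symm
  | trans _ _ _ _ _ ih₁ ih₂ => exact ih₁.trans ih₂

/-- For `n ≥ 1`, pairwise distinct nonzero `λ₁, λ₂, λ₃` and `λ` with
`λ² = −λ₁λ₂λ₃`: the alternating points `αₙ` and `βₙ` are valid points of `Xₙ(ℂ)` and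
are not 𝔸¹-chain equivalent in `Xₙ(ℂ)`. -/
theorem alpha_beta_not_chain_equivalent
    (n : ℕ) (hn : 1 ≤ n)
    (l1 l2 l3 : ℂ) (h1 : l1 ≠ 0) (h2 : l2 ≠ 0) (h3 : l3 ≠ 0)
    (h12 : l1 ≠ l2) (h13 : l1 ≠ l3) (h23 : l2 ≠ l3)
    (lam : ℂ) (hlam : lam ^ 2 = -(l1 * l2 * l3)) :
    (alphaP n, alphaQ lam n) ∈ XnSet l1 l2 l3 n ∧
    (betaP n, betaQ lam n) ∈ XnSet l1 l2 l3 n ∧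
    ∀ (hα : (alphaP n, alphaQ lam n) ∈ XnSet l1 l2 l3 n)
      (hβ : (betaP n, betaQ lam n) ∈ XnSet l1 l2 l3 n),
      ¬ Relation.EqvGen (chainReln l1 l2 l3 n)
          ⟨(alphaP n, alphaQ lam n), hα⟩ ⟨(betaP n, betaQ lam n), hβ⟩ := by
  refine ⟨fun i => ?_, fun i => ?_, fun hα hβ h => ?_⟩
  · by_cases hi : Even (i : ℕ)
    · simp [alphaP, alphaQ, fC, hi, Nat.even_add_one, hlam]
    · simp [alphaP, alphaQ, hi, Nat.even_add_one]
  · by_cases hi : Even (i : ℕ)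
    · simp [betaP, betaQ, hi, Nat.even_add_one]
    · simp [betaP, betaQ, fC, hi, Nat.even_add_one, hlam]
  · have h01 := eqvGen_chainReln_fst_succ_eq h12 h13 h23 h ⟨0, hn⟩
    simp [alphaP, betaP] at h01
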